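/- For every integer n ≥ 1 and every real K > 0 there exist κ > 0 and C₃ > 0 with the following property. Let 0 < E ≤ κ, and let λ₁, …, λₙ be real numbers with 1 + λᵢ > 0 and λᵢ ≤ K·E for every i, such that e^{−E} ≤ ∏ᵢ (1 + λᵢ) ≤ e^{E}. Then ∑ᵢ λᵢ + maxⱼ λⱼ ≥ −2E − C₃ E². -/

import Mathlib

theorem neg_le_sum_of_exp_neg_le_prod_one_add {ι : Type*} (s : Finset ι) {x : ι → ℝ} {E : ℝ}
    (hx : ∀ i ∈ s, 0 ≤ 1 + x i) (hE : Real.exp (-E) ≤ ∏ i ∈ s, (1 + x i)) :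
    -E ≤ ∑ i ∈ s, x i := by
  rw [← Real.exp_le_exp, Real.exp_sum]
  refine hE.trans (Finset.prod_le_prod hx fun i _ => ?_)
  linarith [Real.add_one_le_exp (x i)]

/-- The combined trace plus maximal-eigenvalue lower bound used in the barrier argument:
for all `n ≥ 1` and `K > 0` there are `κ > 0` and `C₃ > 0` such that whenever `0 < E ≤ κ`
and the `λᵢ` satisfy `1 + λᵢ > 0`, `λᵢ ≤ K E` and `e^{-E} ≤ ∏ᵢ (1 + λᵢ) ≤ e^E`, one has
`∑ᵢ λᵢ + maxⱼ λⱼ ≥ -2E - C₃ E²`. -/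
theorem stmt3 (n : ℕ) (hn : 1 ≤ n) (K : ℝ) (hK : 0 < K) :
    ∃ κ > (0 : ℝ), ∃ C₃ > (0 : ℝ), ∀ E : ℝ, 0 < E → E ≤ κ →
      ∀ lam : Fin n → ℝ, (∀ i, 0 < 1 + lam i) → (∀ i, lam i ≤ K * E) →
        Real.exp (-E) ≤ ∏ i, (1 + lam i) → (∏ i, (1 + lam i)) ≤ Real.exp E →
        -2 * E - C₃ * E ^ 2 ≤
          (∑ i, lam i) + (Finset.univ : Finset (Fin n)).sup' ⟨⟨0, hn⟩, Finset.mem_univ _⟩ lam := by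
  refine ⟨1, one_pos, 1, one_pos, fun E hE _ lam hpos _ hprod _ => ?_⟩
  have hsum := neg_le_sum_of_exp_neg_le_prod_one_add Finset.univ (fun i _ => (hpos i).le) hprod
  set M := (Finset.univ : Finset (Fin n)).sup' ⟨⟨0, hn⟩, Finset.mem_univ _⟩ lam
  have hle : ∑ i, lam i ≤ n * M := by
    simpa using Finset.sum_le_card_nsmul Finset.univ lam M
      fun i hi => Finset.le_sup' lam hi
  have hn' : (1 : ℝ) ≤ n := by exact_mod_cast hn
  have hM : -E ≤ M := by
    by_contra! h
    nlinarith
  nlinarith [sq_nonneg E]
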